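/- Let L > 0 and let E : ℝ³ → ℝ³ be continuously differentiable and L-periodic in each coordinate (E(x + L e_i) = E(x) for i = 1,2,3 and all x). If ∇×E = 0 on ℝ³, then ∫_{[0,L]³} E(x) (∇·E)(x) dx = 0, i.e. each component of the vector ∫_{[0,L]³} E (∇·E) dx vanishes. -/

import Mathlib

open Matrix MeasureTheory
open scoped Matrix BigOperators

noncomputable section

/-- Partial derivative of a scalar function on ℝ³ in the `i`-th coordinate direction. -/
def pd3 (f : (Fin 3 → ℝ) → ℝ) (x : Fin 3 → ℝ) (i : Fin 3) : ℝ :=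
  fderiv ℝ f x (Pi.single i 1)

/-- Divergence of a vector field on ℝ³. -/
def div3 (F : (Fin 3 → ℝ) → Fin 3 → ℝ) (x : Fin 3 → ℝ) : ℝ :=
  ∑ i, pd3 (fun y => F y i) x i

/-- Curl of a vector field on ℝ³. -/
def curl3 (F : (Fin 3 → ℝ) → Fin 3 → ℝ) (x : Fin 3 → ℝ) : Fin 3 → ℝ :=
  ![pd3 (fun y => F y 2) x 1 - pd3 (fun y => F y 1) x 2,
    pd3 (fun y => F y 0) x 2 - pd3 (fun y => F y 2) x 0,
    pd3 (fun y => F y 1) x 0 - pd3 (fun y => F y 0) x 1]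

/-- `div3` through the full derivative. -/
theorem div3_eq_fderiv (G : (Fin 3 → ℝ) → Fin 3 → ℝ) (hG : ContDiff ℝ 1 G) (x : Fin 3 → ℝ) :
    div3 G x = ∑ i, fderiv ℝ G x (Pi.single i 1) i := by
  unfold div3 pd3
  refine Finset.sum_congr rfl fun i _ => ?_
  have h := (hG.differentiable one_ne_zero x).hasFDerivAt
  rw [((hasFDerivAt_pi'.1 h) i).fderiv]
  rfl

theorem continuous_div3 (G : (Fin 3 → ℝ) → Fin 3 → ℝ) (hG : ContDiff ℝ 1 G) :
    Continuous (div3 G) := by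
  have h : div3 G = fun x => ∑ i, fderiv ℝ G x (Pi.single i 1) i :=
    funext (div3_eq_fderiv G hG)
  rw [h]
  have hc := hG.continuous_fderiv one_ne_zero
  fun_prop

/-- The divergence of a periodic `C¹` field has zero integral over a period cube. -/
theorem integral_div3_periodic (L : ℝ) (hL : 0 < L)
    (G : (Fin 3 → ℝ) → Fin 3 → ℝ) (hG : ContDiff ℝ 1 G)
    (hper : ∀ (x : Fin 3 → ℝ) (i : Fin 3), G (x + L • (Pi.single i 1 : Fin 3 → ℝ)) = G x) :
    ∫ x in Set.Icc (0 : Fin 3 → ℝ) (fun _ => L), div3 G x = 0 := by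
  have hcd := continuous_div3 G hG
  have hfun : div3 G = fun x => ∑ i, fderiv ℝ G x (Pi.single i 1) i :=
    funext (div3_eq_fderiv G hG)
  rw [hfun] at hcd ⊢
  rw [integral_divergence_of_hasFDerivAt_off_countable (0 : Fin 3 → ℝ) (fun _ => L)
    (fun _ => hL.le) G (fderiv ℝ G) ∅ Set.countable_empty hG.continuous.continuousOn
    (fun x _ => (hG.differentiable one_ne_zero x).hasFDerivAt)
    (hcd.continuousOn.integrableOn_compact isCompact_Icc)]
  refine Finset.sum_eq_zero fun i _ => ?_
  rw [sub_eq_zero]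
  congr 1
  funext y
  have h := hper (i.insertNth ((0 : Fin 3 → ℝ) i) y) i
  rw [← h]
  congr 2
  funext j
  refine Fin.succAboveCases i ?_ (fun k => ?_) j
  · simp
  · simp

theorem hasFDerivAt_stress (E : (Fin 3 → ℝ) → Fin 3 → ℝ) (hE : ContDiff ℝ 1 E)
    (c : ℝ) (i j : Fin 3) (x : Fin 3 → ℝ) (v : Fin 3 → ℝ) :
    fderiv ℝ (fun y => E y i * E y j - c * (E y 0 * E y 0 + E y 1 * E y 1 + E y 2 * E y 2)) x v
      = E x i * fderiv ℝ (fun y => E y j) x v + E x j * fderiv ℝ (fun y => E y i) x v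
        - c * (2 * (E x 0 * fderiv ℝ (fun y => E y 0) x v
          + E x 1 * fderiv ℝ (fun y => E y 1) x v + E x 2 * fderiv ℝ (fun y => E y 2) x v)) := by
  have h : ∀ k, HasFDerivAt (fun y => E y k) (fderiv ℝ (fun y => E y k) x) x := fun k =>
    ((contDiff_pi.1 hE k).differentiable one_ne_zero x).hasFDerivAt
  have := ((h i).mul (h j)).sub
    (((((h 0).mul (h 0)).add ((h 1).mul (h 1))).add ((h 2).mul (h 2))).const_mul c)
  have e := congrArg (fun A : (Fin 3 → ℝ) →L[ℝ] ℝ => A v) this.fderiv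
  refine Eq.trans e ?_
  simp
  ring

/-- Divergence of the `j`-th row of the Maxwell stress tensor of a curl-free field. -/
theorem div3_stress (E : (Fin 3 → ℝ) → Fin 3 → ℝ) (hE : ContDiff ℝ 1 E)
    (hcurl : ∀ x, curl3 E x = 0) (j : Fin 3) (x : Fin 3 → ℝ) :
    div3 (fun y i => E y i * E y j - (if i = j then 1 / 2 else 0) *
      (E y 0 * E y 0 + E y 1 * E y 1 + E y 2 * E y 2)) x = div3 E x * E x j := by
  have h0 := congrFun (hcurl x) 0
  have h1 := congrFun (hcurl x) 1
  have h2 := congrFun (hcurl x) 2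
  simp [curl3, pd3] at h0 h1 h2
  simp only [div3, pd3, hasFDerivAt_stress E hE, Fin.sum_univ_three]
  rw [sub_eq_zero] at h0 h1 h2
  fin_cases j <;> simp [h0, h1, h2] <;> ring

/-- For a periodic, curl-free `C¹` field `E` on ℝ³, the integral of `E (∇·E)` over a
period cube vanishes. -/
theorem periodic_curl_free_integral
    (L : ℝ) (hL : 0 < L)
    (E : (Fin 3 → ℝ) → Fin 3 → ℝ) (hE : ContDiff ℝ 1 E)
    (hper : ∀ (x : Fin 3 → ℝ) (i : Fin 3), E (x + L • (Pi.single i 1 : Fin 3 → ℝ)) = E x)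
    (hcurl : ∀ x, curl3 E x = 0) :
    ∫ x in Set.Icc (0 : Fin 3 → ℝ) (fun _ => L), div3 E x • E x = 0 := by
  have hint : IntegrableOn (fun x => div3 E x • E x) (Set.Icc (0 : Fin 3 → ℝ) (fun _ => L)) :=
    ((continuous_div3 E hE).smul hE.continuous).continuousOn.integrableOn_compact isCompact_Icc
  funext j
  have hev := (ContinuousLinearMap.proj (R := ℝ) (φ := fun _ : Fin 3 => ℝ) j).integral_comp_comm
    hint
  refine Eq.trans hev.symm ?_
  have hcomp : ∀ k, ContDiff ℝ 1 (fun y => E y k) := contDiff_pi.1 hE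
  have key := integral_div3_periodic L hL
    (fun y i => E y i * E y j - (if i = j then 1 / 2 else 0) *
      (E y 0 * E y 0 + E y 1 * E y 1 + E y 2 * E y 2))
    (contDiff_pi.2 fun i => ((hcomp i).mul (hcomp j)).sub
      (contDiff_const.mul ((((hcomp 0).mul (hcomp 0)).add ((hcomp 1).mul (hcomp 1))).add
        ((hcomp 2).mul (hcomp 2)))))
    (fun x i => by simp only [hper])
  simp only [div3_stress E hE hcurl] at key
  simpa using key

end
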